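/- arXiv:0802.2847 — 8 statements merged into one kernel-verified Lean document; each statement's English description precedes it below -/
import Mathlib

section
/- Let G be a finite tree (connected acyclic simple graph) with n ≥ 2 vertices, let s be a vertex of G, and let w be a closed walk from s to s in which every edge of G appears exactly twice in the edge list of w (a 'double Euler tour'), so that w has length 2(n−1) and its entries are the vertices at positions 0,…,2n−2. Fix a chunk size μ ≥ 2 and a chunk index k with (k+1)·μ ≤ 2n−2 (so chunk k is a full chunk not containing the final position). Let r be chosen uniformly at random from the functions V(G) → {0,1} (equivalently, independent fair coin flips, one per vertex). Say a vertex v is 'kept in chunk k' if either r(v)=0 and the first occurrence of v on w lies in positions [k·μ, (k+1)·μ), or r(v)=1 and the last occurrence of v on w lies in positions [k·μ, (k+1)·μ). Then the expected number of vertices kept in chunk k is at least μ/8. -/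
open Finset

namespace SimpleGraph

variable {V : Type*} {G : SimpleGraph V}

/-- A walk that visits one end of a bridge and stops at the other end crosses the bridge. -/
theorem IsBridge.mem_edges_of_mem_support {u v x : V} (h : G.IsBridge s(u, v))
    (p : G.Walk x u) (hv : v ∈ p.support) : s(u, v) ∈ p.edges := by
  classical
  have := isBridge_iff_forall_walk_mem_edges.mp h (p.dropUntil v hv).reverse
  rw [Walk.edges_reverse, List.mem_reverse] at this
  exact p.edges_dropUntil_subset_edges hv this

/-- In a walk using each bridge at most twice, every step along a bridge either reaches its target
for the first time or leaves its source for the last time. -/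
theorem Walk.first_visit_or_last_visit_of_isBridge [DecidableEq V] {s t : V} (w : G.Walk s t)
    {p : ℕ} (hp : p < w.length) (hb : G.IsBridge s(w.getVert p, w.getVert (p + 1)))
    (hcount : w.edges.count s(w.getVert p, w.getVert (p + 1)) ≤ 2) :
    (∀ q < p + 1, w.getVert q ≠ w.getVert (p + 1)) ∨
      ∀ q ≤ w.length, p < q → w.getVert q ≠ w.getVert p := by
  by_contra! ⟨⟨q, hq, hqv⟩, q', hq', hpq', hqu⟩
  have before : s(w.getVert p, w.getVert (p + 1)) ∈ w.edges.take p := by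
    rw [← edges_take]
    refine hb.mem_edges_of_mem_support _ ?_
    rw [← hqv, ← min_eq_right (Nat.lt_succ_iff.mp hq), ← take_getVert]
    exact getVert_mem_support _ _
  have after : s(w.getVert p, w.getVert (p + 1)) ∈ w.edges.drop (p + 1) := by
    rw [← edges_drop, ← List.mem_reverse, ← edges_reverse, Sym2.eq_swap]
    refine IsBridge.mem_edges_of_mem_support (Sym2.eq_swap ▸ hb) _ ?_
    rw [support_reverse, List.mem_reverse, ← hqu,
      ← Nat.add_sub_cancel' (Nat.succ_le_of_lt hpq')]
    simpa only [drop_getVert] using (w.drop (p + 1)).getVert_mem_support (q' - (p + 1))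
  have hp' : p < w.edges.length := by simpa using hp
  have split := congrArg (List.count s(w.getVert p, w.getVert (p + 1)))
    (List.take_append_drop p w.edges)
  rw [List.drop_eq_getElem_cons hp', List.count_append, getElem_edges, List.count_cons_self]
    at split
  have := List.count_pos_iff.mpr before
  have := List.count_pos_iff.mpr after
  omega

end SimpleGraph

/-- If every vertex `v` selects one of two sets by a fair coin `r v`, then the expected number of
vertices lying in their selected set is half the sum of the sizes of the two sets. -/
theorem two_mul_sum_card_filter_mem {V : Type*} [Fintype V] [DecidableEq V]
    (S : Bool → Finset V) :
    2 * ∑ r : V → Bool, #{v | v ∈ S (r v)} =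
      2 ^ Fintype.card V * (#(S false) + #(S true)) := by
  have flip : ∑ r : V → Bool, #{v | v ∈ S (r v)} = ∑ r : V → Bool, #{v | v ∈ S (!r v)} :=
    Fintype.sum_equiv (Equiv.arrowCongr (Equiv.refl V) Equiv.boolNot) _ _ (by simp)
  have pair (r : V → Bool) :
      #{v | v ∈ S (r v)} + #{v | v ∈ S (!r v)} = #(S false) + #(S true) := by
    have card_eq (b : Bool) : #(S b) = ∑ v, if v ∈ S b then 1 else 0 := by simp
    rw [card_filter, card_filter, card_eq, card_eq, ← sum_add_distrib, ← sum_add_distrib]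
    refine sum_congr rfl fun v _ ↦ ?_
    cases r v <;> simp [add_comm]
  rw [two_mul]
  nth_rewrite 2 [flip]
  rw [← sum_add_distrib, sum_congr rfl fun r _ ↦ pair r]
  simp


/-- For a tree `G` on `n ≥ 2` vertices with a double Euler tour `w` from `s`
(every edge appears exactly twice in `w.edges`, so `w.length = 2n - 2`), chunk size `μ ≥ 2`
and a full chunk `k` (with `(k+1)·μ ≤ 2n-2`), the expected number (over a uniformly random
`r : V → Bool`) of vertices `v` kept in chunk `k` — i.e. either `r v = false` and the first
occurrence of `v` lies in `[k·μ, (k+1)·μ)`, or `r v = true` and the last occurrence of `v`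
lies in `[k·μ, (k+1)·μ)` — is at least `μ/8`. -/
theorem stmt_0 {V : Type} [Fintype V] [DecidableEq V] (G : SimpleGraph V)
    (hG : G.IsTree) (n : ℕ) (hn : n = Fintype.card V) (hn2 : 2 ≤ n)
    (s : V) (w : G.Walk s s)
    (hdbl : ∀ e ∈ G.edgeSet, w.edges.count e = 2)
    (hlen : w.length = 2 * n - 2)
    (μ : ℕ) (hμ : 2 ≤ μ) (k : ℕ) (hk : (k + 1) * μ ≤ 2 * n - 2) :
    (μ : ℝ) / 8 ≤
      (∑ r : V → Bool,
        ((Set.ncard {v : V | ∃ p, k * μ ≤ p ∧ p < (k + 1) * μ ∧ w.getVert p = v ∧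
          ((r v = false ∧ ∀ q < p, w.getVert q ≠ v) ∨
           (r v = true ∧ ∀ q ≤ w.length, p < q → w.getVert q ≠ v))} : ℝ)))
        / 2 ^ (Fintype.card V) := by
  classical
  let S (b : Bool) : Finset V := {v | ∃ p, k * μ ≤ p ∧ p < (k + 1) * μ ∧ w.getVert p = v ∧
    ((b = false ∧ ∀ q < p, w.getVert q ≠ v) ∨
      (b = true ∧ ∀ q ≤ w.length, p < q → w.getVert q ≠ v))}
  let I := Ico (k * μ) (k * μ + (μ - 1))
  have chunk_end : (k + 1) * μ = k * μ + μ := by ring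
  let A := I.filter fun p ↦ ∀ q < p + 1, w.getVert q ≠ w.getVert (p + 1)
  let B := I.filter fun p ↦ ∀ q ≤ w.length, p < q → w.getVert q ≠ w.getVert p
  have hA : #A ≤ #(S false) := by
    refine card_le_card_of_injOn (fun p ↦ w.getVert (p + 1)) (fun p hp ↦ ?_) ?_
    · obtain ⟨hpI, hfirst⟩ := mem_filter.mp hp
      have := mem_Ico.mp hpI
      simpa [S] using ⟨p + 1, by omega, by omega, rfl, hfirst⟩
    · intro p hp q hq hpq
      have hp := (mem_filter.mp hp).2
      have hq := (mem_filter.mp hq).2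
      by_contra hne
      rcases Nat.lt_or_gt_of_ne hne with h | h
      · exact hq (p + 1) (by omega) hpq
      · exact hp (q + 1) (by omega) hpq.symm
  have hB : #B ≤ #(S true) := by
    refine card_le_card_of_injOn (fun p ↦ w.getVert p) (fun p hp ↦ ?_) ?_
    · obtain ⟨hpI, hlast⟩ := mem_filter.mp hp
      have := mem_Ico.mp hpI
      simpa [S] using ⟨p, by omega, by omega, rfl, hlast⟩
    · intro p hp q hq hpq
      obtain ⟨hpI, hp⟩ := mem_filter.mp hp
      obtain ⟨hqI, hq⟩ := mem_filter.mp hq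
      have := mem_Ico.mp hpI
      have := mem_Ico.mp hqI
      by_contra hne
      rcases Nat.lt_or_gt_of_ne hne with h | h
      · exact hp q (by omega) h hpq.symm
      · exact hq p (by omega) h hpq
  have cover : I ⊆ A ∪ B := by
    intro p hpI
    have := mem_Ico.mp hpI
    have hp : p < w.length := by omega
    have adj := w.adj_getVert_succ hp
    rw [mem_union, mem_filter, mem_filter, and_iff_right hpI, and_iff_right hpI]
    exact w.first_visit_or_last_visit_of_isBridge hp
      (SimpleGraph.isAcyclic_iff_forall_adj_isBridge.mp hG.isAcyclic adj) (hdbl _ adj).le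
  have size : μ - 1 ≤ #(S false) + #(S true) := calc
    μ - 1 = #I := by simp [I]
    _ ≤ #A + #B := (card_le_card cover).trans (card_union_le A B)
    _ ≤ _ := add_le_add hA hB
  have total : (2 : ℝ) * ∑ r : V → Bool, (#{v | v ∈ S (r v)} : ℝ) =
      2 ^ Fintype.card V * (#(S false) + #(S true)) := by
    exact_mod_cast two_mul_sum_card_filter_mem S
  have kept (r : V → Bool) : Set.ncard {v : V | ∃ p, k * μ ≤ p ∧ p < (k + 1) * μ ∧
      w.getVert p = v ∧ ((r v = false ∧ ∀ q < p, w.getVert q ≠ v) ∨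
        (r v = true ∧ ∀ q ≤ w.length, p < q → w.getVert q ≠ v))} = #{v | v ∈ S (r v)} := by
    rw [← Set.ncard_coe_finset]
    congr 1
    ext v
    simp [S]
  simp only [kept]
  rw [le_div_iff₀ (by positivity)]
  have size' : (μ : ℝ) ≤ #(S false) + #(S true) + 1 := by exact_mod_cast (by omega)
  have hμ' : (2 : ℝ) ≤ μ := by exact_mod_cast hμ
  have pow_pos : (0 : ℝ) < 2 ^ Fintype.card V := by positivity
  nlinarith [mul_le_mul_of_nonneg_left
    (show (μ : ℝ) / 4 ≤ #(S false) + #(S true) by linarith) pow_pos.le]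
end

section
/- Let G be a finite tree with n ≥ 2 vertices, s a vertex, and w a double Euler tour of G from s, with entries at positions 0,…,2n−2. Fix μ ≥ 1 and a window of positions [a, a+μ) with a+μ ≤ 2n−2. Then the number of positions p in [a, a+μ) that are neither the first nor the last occurrence of their vertex is at most ⌈μ/2⌉; equivalently, at least ⌊μ/2⌋ positions in the window are a first or last occurrence of their vertex. -/
theorem half_le_card_filter_Ico (P : ℕ → Prop) [DecidablePred P] (a m : ℕ)
    (h : ∀ p, a ≤ p → p + 1 < a + m → P p ∨ P (p + 1)) :
    m / 2 ≤ ((Finset.Ico a (a + m)).filter P).card := by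
  induction m using Nat.twoStepInduction with
  | zero => simp
  | one => simp
  | more m ih _ =>
    have ih := ih fun p hp hp' => h p hp (by omega)
    have hstep := h (a + m) (by omega) (by omega)
    have h1 : Finset.Ico a (a + (m + 2)) =
        insert (a + m + 1) (insert (a + m) (Finset.Ico a (a + m))) := by
      ext x
      simp only [Finset.mem_Ico, Finset.mem_insert]
      omega
    rw [h1, Finset.filter_insert, Finset.filter_insert]
    split_ifs <;> simp_all <;> omega

namespace SimpleGraph.Walk

variable {V : Type*} {G : SimpleGraph V}

theorem edges_eq_edges_take_append_cons_edges_drop {s t : V} (w : G.Walk s t) {p : ℕ} (hp : p < w.length) :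
    w.edges = (w.take p).edges ++
      s(w.getVert p, w.getVert (p + 1)) :: (w.drop (p + 1)).edges := by
  induction w generalizing p with
  | nil => simp at hp
  | cons h w ih =>
    cases p with
    | zero => simp [take, drop]
    | succ p => simpa [take, drop] using ih (by simpa using hp)

/-- If a walk in an acyclic graph traverses each of its edges at most twice, then of any two
consecutive positions the first is the last visit to its vertex or the second is the first visit
to its vertex. -/
theorem last_or_first_occurrence [DecidableEq V] (hG : G.IsAcyclic) {s t : V} (w : G.Walk s t)
    (hcount : ∀ e ∈ G.edgeSet, w.edges.count e ≤ 2) {p : ℕ} (hp : p < w.length) :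
    (∀ q ≤ w.length, p < q → w.getVert q ≠ w.getVert p) ∨
      ∀ q < p + 1, w.getVert q ≠ w.getVert (p + 1) := by
  by_contra! ⟨⟨r, hr, hpr, hrp⟩, q, hq, hqp⟩
  have hadj := w.adj_getVert_succ hp
  have hbridge := isAcyclic_iff_forall_isBridge.1 hG (G.mem_edgeSet.2 hadj)
  have hmem := isBridge_iff_forall_walk_mem_edges.1 hbridge
  have hy : w.getVert (p + 1) ∈ (w.take p).support := by
    rw [← hqp]
    have := (w.take p).getVert_mem_support q
    rwa [take_getVert, min_eq_right (by omega)] at this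
  have hx : w.getVert p ∈ (w.drop (p + 1)).support := by
    rw [← hrp]
    have := (w.drop (p + 1)).getVert_mem_support (r - (p + 1))
    have h : p + 1 ≠ r := by rintro rfl; exact hadj.ne hrp.symm
    rwa [drop_getVert, Nat.add_sub_cancel' (by omega)] at this
  have h1 : s(w.getVert p, w.getVert (p + 1)) ∈ (w.take p).edges := by
    have := hmem ((w.take p).dropUntil _ hy).reverse
    rw [edges_reverse, List.mem_reverse] at this
    exact edges_dropUntil_subset_edges _ hy this
  have h2 : s(w.getVert p, w.getVert (p + 1)) ∈ (w.drop (p + 1)).edges := by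
    have := hmem ((w.drop (p + 1)).takeUntil _ hx).reverse
    rw [edges_reverse, List.mem_reverse] at this
    exact edges_takeUntil_subset_edges _ hx this
  have hc := hcount _ (G.mem_edgeSet.2 hadj)
  rw [w.edges_eq_edges_take_append_cons_edges_drop hp, List.count_append, List.count_cons_self] at hc
  have := List.count_pos_iff.2 h1
  have := List.count_pos_iff.2 h2
  omega

end SimpleGraph.Walk

/-- For a tree `G` on `n ≥ 2` vertices with a double Euler tour `w` from `s`
(length `2n-2`), and a window `[a, a+μ)` of `μ ≥ 1` positions with `a + μ ≤ 2n-2`, the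
number of positions in the window that are neither a first nor a last occurrence of their
vertex is at most `⌈μ/2⌉`; equivalently, at least `⌊μ/2⌋` positions in the window are a
first or a last occurrence of their vertex. -/
theorem stmt_1 {V : Type} [Fintype V] [DecidableEq V] (G : SimpleGraph V)
    (hG : G.IsTree) (n : ℕ) (hn : n = Fintype.card V) (hn2 : 2 ≤ n)
    (s : V) (w : G.Walk s s)
    (hdbl : ∀ e ∈ G.edgeSet, w.edges.count e = 2)
    (hlen : w.length = 2 * n - 2)
    (μ a : ℕ) (hμ : 1 ≤ μ) (ha : a + μ ≤ 2 * n - 2) :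
    {p ∈ Set.Ico a (a + μ) |
        ¬ (∀ q < p, w.getVert q ≠ w.getVert p) ∧
        ¬ (∀ q ≤ w.length, p < q → w.getVert q ≠ w.getVert p)}.ncard ≤ (μ + 1) / 2 ∧
    μ / 2 ≤
      {p ∈ Set.Ico a (a + μ) |
        (∀ q < p, w.getVert q ≠ w.getVert p) ∨
        (∀ q ≤ w.length, p < q → w.getVert q ≠ w.getVert p)}.ncard := by
  classical
  set P : ℕ → Prop := fun p => (∀ q < p, w.getVert q ≠ w.getVert p) ∨
    (∀ q ≤ w.length, p < q → w.getVert q ≠ w.getVert p) with hP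
  have hgood : {p ∈ Set.Ico a (a + μ) | P p} =
      ((Finset.Ico a (a + μ)).filter P : Set ℕ) := by
    ext p; simp
  have hbad : {p ∈ Set.Ico a (a + μ) |
        ¬ (∀ q < p, w.getVert q ≠ w.getVert p) ∧
        ¬ (∀ q ≤ w.length, p < q → w.getVert q ≠ w.getVert p)} =
      ((Finset.Ico a (a + μ)).filter (¬ P ·) : Set ℕ) := by
    ext p
    simp only [Finset.coe_filter, Finset.mem_Ico, Set.mem_ofPred_eq, Set.mem_Ico, hP, not_or]
  have hge := half_le_card_filter_Ico P a μ fun p _ hp' =>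
    (w.last_or_first_occurrence hG.isAcyclic (fun e he => (hdbl e he).le)
      (p := p) (by omega)).imp Or.inr Or.inl
  have hsum := Finset.card_filter_add_card_filter_not (s := Finset.Ico a (a + μ)) P
  rw [Nat.card_Ico] at hsum
  rw [hbad, hgood, Set.ncard_coe_finset, Set.ncard_coe_finset]
  omega
end

section
/- Let G be a finite tree with n ≥ 2 vertices, s a vertex, and w a double Euler tour of G from s, with entries at positions 0,…,2n−2. If position p is an intermediate visit (i.e., neither the first nor the last occurrence of the vertex w.getVert p), then position p−1 is the last occurrence of the vertex w.getVert (p−1), and position p+1 is the first occurrence of the vertex w.getVert (p+1). -/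
namespace SimpleGraph.Walk

variable {V : Type*} {G : SimpleGraph V}

/-- A walk passing between the two sides of a bridge traverses it. -/
theorem exists_edge_eq_of_isBridge {a b u v : V} (w : G.Walk a b) (hb : G.IsBridge s(u, v))
    {i j : ℕ} (hij : i ≤ j) (hj : j ≤ w.length)
    (h : s(w.getVert i, w.getVert j) = s(u, v)) :
    ∃ k, i ≤ k ∧ k < j ∧ s(w.getVert k, w.getVert (k + 1)) = s(u, v) := by
  by_contra! hne
  have hreach : ∀ m, i ≤ m → m ≤ j →
      (G.deleteEdges {s(u, v)}).Reachable (w.getVert i) (w.getVert m) := by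
    intro m him
    induction m, him using Nat.le_induction with
    | base => exact fun _ => .refl _
    | succ m him ih =>
      intro hmj
      refine (ih (by omega)).trans (Adj.reachable ?_)
      rw [deleteEdges_adj]
      exact ⟨w.adj_getVert_succ (by omega), hne m him (by omega)⟩
  have hr := hreach j hij le_rfl
  have hnot : ¬ (G.deleteEdges {s(u, v)}).Reachable u v := isBridge_iff.1 hb
  rcases Sym2.eq_iff.1 h with ⟨h1, h2⟩ | ⟨h1, h2⟩
  · exact hnot (by rwa [h1, h2] at hr)
  · exact hnot (by rw [h1, h2] at hr; exact hr.symm)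

/-- If a walk in a forest traverses no edge more than twice, then the vertex it leaves when it
returns to an already visited vertex is never visited again. -/
theorem getVert_ne_getVert_of_not_first [DecidableEq V] (hG : G.IsAcyclic) {a b : V}
    (w : G.Walk a b) (hcount : ∀ e ∈ G.edgeSet, w.edges.count e ≤ 2) {q p r : ℕ}
    (hqp : q < p + 1) (hq : w.getVert q = w.getVert (p + 1)) (hpr : p < r)
    (hr : r ≤ w.length) : w.getVert r ≠ w.getVert p := by
  intro hrp
  have hadj : G.Adj (w.getVert p) (w.getVert (p + 1)) := w.adj_getVert_succ (by omega)
  have hb : G.IsBridge s(w.getVert p, w.getVert (p + 1)) :=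
    isAcyclic_iff_forall_adj_isBridge.1 hG hadj
  obtain ⟨i, -, hip, hi⟩ := w.exists_edge_eq_of_isBridge hb (i := q) (j := p) (by omega)
    (by omega) (by rw [hq, Sym2.eq_swap])
  obtain ⟨j, hpj, hjr, hj⟩ := w.exists_edge_eq_of_isBridge hb (i := p + 1) (j := r) (by omega)
    hr (by rw [hrp, Sym2.eq_swap])
  have hlen := w.length_edges
  have hi' : s(w.getVert p, w.getVert (p + 1)) ∈ w.edges.take p :=
    List.mem_take_iff_getElem.2 ⟨i, by omega, by rw [getElem_edges, hi]⟩
  have hj' : s(w.getVert p, w.getVert (p + 1)) ∈ w.edges.drop (p + 1) :=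
    List.mem_drop_iff_getElem.2 ⟨j - (p + 1), by omega, by
      rw [getElem_edges, ← hj]; congr <;> omega⟩
  have h2 := hcount _ (G.mem_edgeSet.2 hadj)
  rw [← List.take_append_drop p w.edges, List.count_append,
    List.drop_eq_getElem_cons (by omega : p < w.edges.length), getElem_edges,
    List.count_cons_self] at h2
  have := List.count_pos_iff.2 hi'
  have := List.count_pos_iff.2 hj'
  omega

end SimpleGraph.Walk


/-- For a tree `G` on `n ≥ 2` vertices with a double Euler tour `w` from `s`
(length `2n-2`), if position `p ≤ w.length` is an intermediate visit (neither the first nor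
the last occurrence of the vertex `w.getVert p`), then position `p-1` is the last occurrence
of the vertex `w.getVert (p-1)` and position `p+1` is the first occurrence of the vertex
`w.getVert (p+1)`. -/
theorem stmt_2 {V : Type} [Fintype V] [DecidableEq V] (G : SimpleGraph V)
    (hG : G.IsTree) (n : ℕ) (hn : n = Fintype.card V) (hn2 : 2 ≤ n)
    (s : V) (w : G.Walk s s)
    (hdbl : ∀ e ∈ G.edgeSet, w.edges.count e = 2)
    (hlen : w.length = 2 * n - 2)
    (p : ℕ) (hp : p ≤ w.length)
    (hfirst : ¬ (∀ q < p, w.getVert q ≠ w.getVert p))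
    (hlast : ¬ (∀ q ≤ w.length, p < q → w.getVert q ≠ w.getVert p)) :
    (∀ q ≤ w.length, p - 1 < q → w.getVert q ≠ w.getVert (p - 1)) ∧
    (∀ q < p + 1, w.getVert q ≠ w.getVert (p + 1)) := by
  push Not at hfirst hlast
  obtain ⟨q, hq, hqp⟩ := hfirst
  obtain ⟨r, hr, hpr, hrp⟩ := hlast
  obtain ⟨p, rfl⟩ : ∃ m, p = m + 1 := ⟨p - 1, by omega⟩
  refine ⟨fun t ht hpt => w.getVert_ne_getVert_of_not_first hG.isAcyclic
    (fun e he => (hdbl e he).le) hq hqp hpt ht, fun t ht htp => ?_⟩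
  have hrev : ∀ k ≤ w.length, w.reverse.getVert (w.length - k) = w.getVert k := by
    intro k hk
    rw [SimpleGraph.Walk.getVert_reverse]
    congr 1
    omega
  have hp1 : w.length - (p + 1) = w.length - (p + 2) + 1 := by omega
  refine w.reverse.getVert_ne_getVert_of_not_first hG.isAcyclic (q := w.length - r)
    (p := w.length - (p + 2)) (r := w.length - t) (fun e he => ?_) (by omega) ?_ (by omega)
    (by simp) ?_
  · simpa using (hdbl e he).le
  · rw [← hp1, hrev _ hr, hrev _ hp, hrp]
  · rw [hrev _ (by omega), hrev _ (by omega), htp]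
end

section
/- Let G be a finite tree, s a vertex, and w a closed walk from s to s in which every edge of G appears exactly twice in the list of edges traversed by w. Then for every edge {a,b} of G, the dart (directed edge) from a to b occurs exactly once among the darts of w, and the dart from b to a occurs exactly once among the darts of w; that is, each edge is traversed exactly once in each direction. -/
namespace SimpleGraph

variable {V : Type*} [DecidableEq V] {G : SimpleGraph V}

/-- An edge of a walk is traversed as often as its two darts together. -/
theorem Walk.count_edges_eq_countP_darts_add {a b : V} (hab : a ≠ b) {u v : V}
    (w : G.Walk u v) :
    w.edges.count s(a, b) = w.darts.countP (fun d => d.toProd = (a, b)) +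
      w.darts.countP (fun d => d.toProd = (b, a)) := by
  induction w with
  | nil => simp
  | @cons u x v h p ih =>
    simp only [Walk.edges_cons, Walk.darts_cons, List.count_cons, List.countP_cons, ih]
    by_cases h₁ : u = a ∧ x = b
    · obtain ⟨rfl, rfl⟩ := h₁
      simp [hab, add_right_comm]
    · by_cases h₂ : u = b ∧ x = a
      · obtain ⟨rfl, rfl⟩ := h₂
        simp [hab, add_assoc]
      · simp [h₁, h₂]

open Classical in
/-- Crossings of a bridge in the two directions balance, up to the sides on which the walk
starts and ends. -/
theorem IsBridge.countP_darts_add {a b : V} (hb : G.IsBridge s(a, b)) {u v : V}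
    (w : G.Walk u v) :
    w.darts.countP (fun d => d.toProd = (a, b)) +
        (if (G.deleteEdges {s(a, b)}).Reachable a v then 1 else 0) =
      w.darts.countP (fun d => d.toProd = (b, a)) +
        (if (G.deleteEdges {s(a, b)}).Reachable a u then 1 else 0) := by
  have hnr : ¬ (G.deleteEdges {s(a, b)}).Reachable a b := isBridge_iff.mp hb
  have hab : a ≠ b := by
    rintro rfl
    exact hnr (Reachable.refl _)
  induction w with
  | nil => simp
  | @cons u x v h p ih =>
    simp only [Walk.darts_cons, List.countP_cons]
    by_cases h₁ : u = a ∧ x = b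
    · obtain ⟨rfl, rfl⟩ := h₁
      simp [hab, hnr] at ih ⊢
      omega
    · by_cases h₂ : u = b ∧ x = a
      · obtain ⟨rfl, rfl⟩ := h₂
        simp [hab, hnr] at ih ⊢
        omega
      · have hux : (G.deleteEdges {s(a, b)}).Adj u x := by
          simp [deleteEdges_adj, h, h₁, h₂]
        have hiff : (G.deleteEdges {s(a, b)}).Reachable a u ↔
            (G.deleteEdges {s(a, b)}).Reachable a x :=
          ⟨fun r => r.trans hux.reachable, fun r => r.trans hux.symm.reachable⟩
        simpa [h₁, h₂, hiff] using ih

/-- A closed walk crosses a bridge equally often in both directions. -/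
theorem IsBridge.countP_darts_eq_of_closed {a b : V} (hb : G.IsBridge s(a, b)) {s : V}
    (w : G.Walk s s) :
    w.darts.countP (fun d => d.toProd = (a, b)) =
      w.darts.countP (fun d => d.toProd = (b, a)) :=
  Nat.add_right_cancel (hb.countP_darts_add w)

end SimpleGraph

/-- If `G` is a finite tree and `w` is a closed walk from `s` to `s` in which
every edge of `G` appears exactly twice, then for every edge `{a,b}` of `G` the dart from
`a` to `b` occurs exactly once among the darts of `w`, and likewise the dart from `b` to
`a`: each edge is traversed exactly once in each direction. -/
theorem stmt_6 {V : Type} [Fintype V] [DecidableEq V] (G : SimpleGraph V)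
    (hG : G.IsTree) (s : V) (w : G.Walk s s)
    (hdbl : ∀ e ∈ G.edgeSet, w.edges.count e = 2) :
    ∀ a b : V, G.Adj a b →
      (w.darts.filter (fun d => d.toProd = (a, b))).length = 1 ∧
      (w.darts.filter (fun d => d.toProd = (b, a))).length = 1 := by
  intro a b hab
  have hsum := w.count_edges_eq_countP_darts_add hab.ne
  have hbal := (SimpleGraph.isAcyclic_iff_forall_adj_isBridge.mp hG.isAcyclic hab)
    |>.countP_darts_eq_of_closed w
  rw [hdbl s(a, b) hab] at hsum
  simp only [← List.countP_eq_length_filter]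
  omega
end

section
/- Let H and G be simple graphs on the same vertex set with H ≤ G (every edge of H is an edge of G), let s, v, v' be vertices, and let μ ≥ 1 be a natural number. Assume v and v' are reachable from s in H, that dist_H(v, v') ≤ μ, and that dist_H(s, v) > dist_G(s, v) + 4μ. Then dist_H(s, v') > dist_G(s, v') + 2μ. -/
/-- Let `H ≤ G` be simple graphs on the same vertex set, `s, v, v'` vertices,
`μ ≥ 1`. If `v` and `v'` are reachable from `s` in `H`, `dist_H(v,v') ≤ μ`, and
`dist_H(s,v) > dist_G(s,v) + 4μ`, then `dist_H(s,v') > dist_G(s,v') + 2μ`. -/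
theorem stmt_8 {V : Type} (H G : SimpleGraph V) (hHG : H ≤ G)
    (s v v' : V) (μ : ℕ) (hμ : 1 ≤ μ)
    (hv : H.Reachable s v) (hv' : H.Reachable s v')
    (hvv' : H.dist v v' ≤ μ)
    (hbig : G.dist s v + 4 * μ < H.dist s v) :
    G.dist s v' + 2 * μ < H.dist s v' := by
  have hH : H.dist s v ≤ H.dist s v' + H.dist v v' := by
    rw [H.dist_comm (u := v)]
    exact hv'.dist_triangle_left v
  have hG : G.dist s v' ≤ G.dist s v + G.dist v v' := (hv.mono hHG).dist_triangle_left v'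
  have hanti : G.dist v v' ≤ H.dist v v' := (hv.symm.trans hv').dist_anti hHG
  omega
end

section
/- Let G be a simple graph and let u, v, s be vertices such that u and v are not connected in G (¬Reachable_G u v) and s is reachable from u in G. Let G' be the graph obtained from G by inserting the edge {u,v}. Then for every vertex t that is reachable from v in G, t is reachable from s in G' and dist_{G'}(s, t) = dist_G(s, u) + 1 + dist_G(v, t). -/
namespace SimpleGraph

/-- Lengths of walks in `G ⊔ edge u v` ending in the component of `v`, where `u` and `v` lie in
different components of `G`. -/
theorem Walk.dist_le_length_of_sup_edge {V : Type*} {G : SimpleGraph V} {u v x t : V}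
    (huv : ¬ G.Reachable u v) (p : (G ⊔ edge u v).Walk x t) (ht : G.Reachable v t) :
    (G.Reachable u x → G.dist x u + 1 + G.dist v t ≤ p.length) ∧
      (G.Reachable v x → G.dist x t ≤ p.length) := by
  induction p with
  | nil => exact ⟨fun hu => (huv (hu.trans ht.symm)).elim, fun _ => by simp⟩
  | @cons x y t h p ih =>
    obtain ⟨ihu, ihv⟩ := ih ht
    rw [Walk.length_cons]
    rw [sup_adj, edge_adj] at h
    obtain h | ⟨⟨rfl, rfl⟩ | ⟨rfl, rfl⟩, -⟩ := h
    · have hxy : G.dist x y = 1 := dist_eq_one_iff_adj.2 h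
      constructor <;> intro hx
      · have := ihu (hx.trans h.reachable)
        have := h.reachable.dist_triangle_left u
        omega
      · have := ihv (hx.trans h.reachable)
        have := h.reachable.dist_triangle_left t
        omega
    · refine ⟨fun _ => ?_, fun hx => (huv hx.symm).elim⟩
      have := ihv .rfl
      rw [dist_self]
      omega
    · refine ⟨fun hx => (huv hx).elim, fun _ => ?_⟩
      have := ihu .rfl
      omega

end SimpleGraph

/-- Type A update: Let `u, v` be vertices not connected in `G` and let `s`
be reachable from `u` in `G`. Insert the edge `{u,v}` to obtain `G' = G ⊔ edge u v`. Then
every vertex `t` reachable from `v` in `G` is reachable from `s` in `G'`, and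
`dist_{G'}(s,t) = dist_G(s,u) + 1 + dist_G(v,t)`. -/
theorem stmt_9 {V : Type} (G : SimpleGraph V) (u v s : V)
    (huv : ¬ G.Reachable u v) (hsu : G.Reachable u s) :
    ∀ t : V, G.Reachable v t →
      (G ⊔ SimpleGraph.edge u v).Reachable s t ∧
      (G ⊔ SimpleGraph.edge u v).dist s t = G.dist s u + 1 + G.dist v t := by
  intro t ht
  obtain ⟨p, hp⟩ := hsu.symm.exists_walk_length_eq_dist
  obtain ⟨q, hq⟩ := ht.exists_walk_length_eq_dist
  have huv_adj : (G ⊔ SimpleGraph.edge u v).Adj u v :=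
    Or.inr ((SimpleGraph.edge_adj u v u v).2
      ⟨Or.inl ⟨rfl, rfl⟩, fun h => huv (h ▸ SimpleGraph.Reachable.rfl)⟩)
  let w : (G ⊔ SimpleGraph.edge u v).Walk s t :=
    (p.mapLe le_sup_left).append (.cons huv_adj (q.mapLe le_sup_left))
  have hw : w.length = G.dist s u + 1 + G.dist v t := by
    simp [w, hp, hq, add_assoc, add_comm 1]
  refine ⟨w.reachable, le_antisymm (hw ▸ SimpleGraph.dist_le w) ?_⟩
  obtain ⟨r, hr⟩ := w.reachable.exists_walk_length_eq_dist
  exact hr ▸ (r.dist_le_length_of_sup_edge huv ht).1 hsu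
end

section
/- Let G be a simple graph and let u, v, s be vertices such that u and v are not connected in G (¬Reachable_G u v) and s is reachable from u in G. Let G' be the graph obtained from G by inserting the edge {u,v}. Then for every vertex t that is reachable from s in G, dist_{G'}(s, t) = dist_G(s, t); that is, inserting a bridge to a different connected component does not change any distance from s within the component of s. -/
/-- A map sending adjacent vertices to equal or adjacent vertices does not lengthen walks. -/
theorem SimpleGraph.Walk.exists_length_le_of_adj_imp_eq_or_adj {V W : Type*}
    {G : SimpleGraph V} {H : SimpleGraph W} {f : V → W}
    (hf : ∀ a b, G.Adj a b → f a = f b ∨ H.Adj (f a) (f b)) {a b : V} (p : G.Walk a b) :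
    ∃ q : H.Walk (f a) (f b), q.length ≤ p.length := by
  induction p with
  | nil => exact ⟨.nil, le_rfl⟩
  | cons h p ih =>
    obtain ⟨q, hq⟩ := ih
    rcases hf _ _ h with h' | h'
    · exact ⟨q.copy h'.symm rfl, by simp; omega⟩
    · exact ⟨.cons h' q, by simpa using hq⟩

/-- Let `u, v` be vertices not connected in `G` and let `s` be reachable
from `u` in `G`. Insert the edge `{u,v}` to obtain `G' = G ⊔ edge u v`. Then for every
vertex `t` reachable from `s` in `G`, `dist_{G'}(s,t) = dist_G(s,t)`: inserting a bridge
to a different connected component does not change distances from `s` within the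
component of `s`. -/
theorem stmt_10 {V : Type} (G : SimpleGraph V) (u v s : V)
    (huv : ¬ G.Reachable u v) (hsu : G.Reachable u s) :
    ∀ t : V, G.Reachable s t →
      (G ⊔ SimpleGraph.edge u v).dist s t = G.dist s t := by
  classical
  intro t hst
  refine le_antisymm (hst.dist_anti le_sup_left) ?_
  obtain ⟨p, hp⟩ := (hst.mono (le_sup_left (b := SimpleGraph.edge u v))).exists_walk_length_eq_dist
  obtain ⟨q, hq⟩ := p.exists_length_le_of_adj_imp_eq_or_adj (H := G)
    (f := fun w ↦ if G.Reachable u w then w else u) fun a b hab ↦ by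
      rcases hab with hab | hab
      · have hiff : G.Reachable u a ↔ G.Reachable u b :=
          ⟨fun h ↦ h.trans hab.reachable, fun h ↦ h.trans hab.symm.reachable⟩
        by_cases h : G.Reachable u b <;> simp [hiff, h, hab]
      · rw [SimpleGraph.edge_adj] at hab
        rcases hab.1 with ⟨rfl, rfl⟩ | ⟨rfl, rfl⟩ <;> simp [huv]
  have hdist := G.dist_le q
  simp only [hsu, hsu.trans hst, if_true] at hdist
  exact hdist.trans (hq.trans hp.le)
end

section
/- Let G be a simple graph, s a vertex, and t ≥ 2 a natural number. Then the set of vertices at BFS level t equals the set of neighbors of level-(t−1) vertices with the vertices of levels t−1 and t−2 removed; precisely: { v | Reachable_G s v ∧ dist_G(s,v) = t } = { v | (∃ u, Adj_G u v ∧ Reachable_G s u ∧ dist_G(s,u) = t−1) ∧ dist_G(s,v) ≠ t−1 ∧ dist_G(s,v) ≠ t−2 }. -/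
/-- A reachable vertex at positive distance from `s` has a neighbor one step closer to `s`. -/
theorem SimpleGraph.Reachable.exists_adj_dist_add_one_eq {V : Type*} {G : SimpleGraph V} {s v : V}
    (hr : G.Reachable s v) (hne : s ≠ v) :
    ∃ u, G.Adj u v ∧ G.Reachable s u ∧ G.dist s u + 1 = G.dist s v := by
  obtain ⟨p, hp⟩ := hr.symm.exists_walk_length_eq_dist
  cases p with
  | nil => exact absurd rfl hne
  | @cons _ u _ h p =>
    refine ⟨u, h.symm, p.reachable.symm, ?_⟩
    have hle := SimpleGraph.dist_le p
    rw [SimpleGraph.Walk.length_cons, SimpleGraph.dist_comm] at hp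
    rw [SimpleGraph.dist_comm] at hle
    have hdiff := h.diff_dist_adj (u := s)
    omega

/-- For a simple graph `G`, source `s` and level `t ≥ 2`, the set of
vertices at BFS level `t` equals the set of neighbors of level-`(t-1)` vertices with the
vertices of levels `t-1` and `t-2` removed:
`L(t) = A'(t) \ (L(t-1) ∪ L(t-2))`. -/
theorem stmt_14 {V : Type} (G : SimpleGraph V) (s : V) (t : ℕ) (ht : 2 ≤ t) :
    {v : V | G.Reachable s v ∧ G.dist s v = t} =
    {v : V | (∃ u : V, G.Adj u v ∧ G.Reachable s u ∧ G.dist s u = t - 1) ∧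
      G.dist s v ≠ t - 1 ∧ G.dist s v ≠ t - 2} := by
  ext v
  simp only [Set.mem_ofPred_eq]
  constructor
  · rintro ⟨hr, hd⟩
    have hne : s ≠ v := by
      rintro rfl
      rw [SimpleGraph.dist_self] at hd
      omega
    obtain ⟨u, huv, hu, hdu⟩ := hr.exists_adj_dist_add_one_eq hne
    exact ⟨⟨u, huv, hu, by omega⟩, by omega, by omega⟩
  · rintro ⟨⟨u, huv, hu, hdu⟩, h₁, h₂⟩
    have hdiff := huv.diff_dist_adj (u := s)
    exact ⟨hu.trans huv.reachable, by omega⟩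
end
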